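/- Let d be an admissible sequence and a an admissible family. Then for every real s > 0 the series G(s) = Σ_{m≥0} Σ_{n∈ℤ} c^{2n+m} q^{n-m/2} d_m a(n,m) · Σ_{l ≥ max(l₁, n+m+1)} (c^{-1}α^{-1})^l q^{l/2} (q^{s(2l-2n-m)} - q^{s(|n+m|+|n|)}) converges absolutely, and lim_{s→0⁺} s·G(s) = 0. -/

import Mathlib

open Filter Topology

noncomputable section

/-- `qc q x` is the real power `q ^ x`, viewed as a complex number. -/
def qc (q : ℝ) (x : ℝ) : ℂ := ((q ^ x : ℝ) : ℂ)

/-- An admissible sequence: `d m = q^(m/2) (c₁ c^m + c₂ c^(-m))` for all `m ≥ l₁`. -/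
def IsAdmissibleSeq (q : ℝ) (c : ℂ) (l₁ : ℤ) (d : ℕ → ℂ) : Prop :=
  ∃ c₁ c₂ : ℂ, ∀ m : ℕ, l₁ ≤ (m : ℤ) →
    d m = qc q ((m : ℝ) / 2) * (c₁ * c ^ (m : ℤ) + c₂ * c ^ (-(m : ℤ)))

/-- An admissible family on `ℤ × ℕ`, given by region asymptotics. -/
def IsAdmissibleFam (q : ℝ) (l₁ : ℤ) (a : ℤ → ℕ → ℂ) : Prop :=
  ∃ (k₁ k₂ k₃ : ℂ) (A B : ℤ → ℂ), ∀ (n : ℤ) (m : ℕ),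
    (l₁ ≤ n → a n m = k₁) ∧
    (-l₁ < n → n < l₁ → l₁ ≤ n + (m : ℤ) → a n m = A n) ∧
    (n ≤ -l₁ → l₁ ≤ n + (m : ℤ) → a n m = qc q (-(n : ℝ)) * k₂) ∧
    (n ≤ -l₁ → -l₁ < n + (m : ℤ) → n + (m : ℤ) < l₁ →
      a n m = qc q (-(n : ℝ)) * B (n + m)) ∧
    (n + (m : ℤ) ≤ -l₁ → a n m = qc q (-(2 * (n : ℝ) + (m : ℝ))) * k₃)

/-- An `l`-stabilized family on `ℤ × ℕ` (the regions do not depend on `l`). -/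
def IsStabilizedFam (q : ℝ) (c : ℂ) (l₁ : ℤ) (e : ℤ → ℕ → ℂ) : Prop :=
  ∃ (u w : ℂ) (f v : ℤ → ℂ) (N : ℤ), 2 * l₁ < N ∧ ∀ (n : ℤ) (m : ℕ),
    (l₁ ≤ n → e n m = (c ^ 2 * (q : ℂ)) ^ n * (c * qc q (1 / 2)) ^ m * u) ∧
    (-l₁ < n → n < l₁ → N ≤ (m : ℤ) → e n m = (c * qc q (1 / 2)) ^ m * f n) ∧
    (n ≤ -l₁ → -l₁ < n + (m : ℤ) → n + (m : ℤ) < l₁ → N ≤ (m : ℤ) →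
      e n m = qc q ((m : ℝ) / 2) * c ^ (-(m : ℤ)) * v (n + m)) ∧
    (n + (m : ℤ) ≤ -l₁ → e n m = (c ^ 2 * (q : ℂ)⁻¹) ^ n * (c * qc q (-(1 / 2))) ^ m * w)

lemma norm_qc {q : ℝ} (hq : 0 < q) (x : ℝ) : ‖qc q x‖ = q ^ x := by
  rw [qc, Complex.norm_real, Real.norm_of_nonneg (Real.rpow_nonneg hq.le x)]

lemma exists_bound_on_finset {ι : Type*} (S : Finset ι) (f : ι → ℂ) :
    ∃ M : ℝ, 0 ≤ M ∧ ∀ x ∈ S, ‖f x‖ ≤ M :=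
  ⟨∑ x ∈ S, ‖f x‖, Finset.sum_nonneg fun _ _ => norm_nonneg _, fun _ hx =>
    Finset.single_le_sum (f := fun x => ‖f x‖) (fun _ _ => norm_nonneg _) hx⟩

lemma abs_rpow_sub_rpow_le {q s x y z : ℝ} (hq0 : 0 < q) (hq1 : q < 1) (hs : 0 < s)
    (hx : z ≤ x) (hy : z ≤ y) :
    |q ^ (s * x) - q ^ (s * y)| ≤ q ^ (s * z) * (s * -Real.log q * |x - y|) := by
  wlog hxy : x ≤ y generalizing x y
  · rw [abs_sub_comm, abs_sub_comm x]
    exact this hy hx (le_of_not_ge hxy)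
  have h1 : q ^ (s * y) = q ^ (s * x) * q ^ (s * (y - x)) := by
    rw [← Real.rpow_add hq0]; ring_nf
  have h2 : q ^ (s * (y - x)) ≤ 1 :=
    Real.rpow_le_one hq0.le hq1.le (mul_nonneg hs.le (by linarith))
  have h3 : 1 + Real.log q * (s * (y - x)) ≤ q ^ (s * (y - x)) := by
    rw [Real.rpow_def_of_pos hq0, add_comm]
    exact Real.add_one_le_exp _
  have h4 : q ^ (s * x) ≤ q ^ (s * z) :=
    Real.rpow_le_rpow_of_exponent_ge hq0 hq1.le (mul_le_mul_of_nonneg_left hx hs.le)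
  have h5 : q ^ (s * x) - q ^ (s * y) = q ^ (s * x) * (1 - q ^ (s * (y - x))) := by
    rw [h1]; ring
  have h6 : 0 < q ^ (s * x) := Real.rpow_pos_of_pos hq0 _
  rw [h5, abs_of_nonneg (mul_nonneg h6.le (by linarith)), abs_sub_comm, abs_of_nonneg (by linarith)]
  exact mul_le_mul h4 (by linarith) (by linarith) (Real.rpow_nonneg hq0.le _)

lemma IsAdmissibleSeq.exists_norm_le {q : ℝ} {c : ℂ} {l₁ : ℤ} {d : ℕ → ℂ}
    (hd : IsAdmissibleSeq q c l₁ d) (hq0 : 0 < q) (hc : ‖c‖ = 1) :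
    ∃ D : ℝ, 0 ≤ D ∧ ∀ m, ‖d m‖ ≤ D * q ^ ((m : ℝ) / 2) := by
  obtain ⟨c₁, c₂, h⟩ := hd
  obtain ⟨M, hM, hM'⟩ := exists_bound_on_finset (Finset.range l₁.toNat)
    fun m => d m * qc q (-((m : ℝ) / 2))
  refine ⟨M + (‖c₁‖ + ‖c₂‖), by positivity, fun m => ?_⟩
  have hp : 0 < q ^ ((m : ℝ) / 2) := Real.rpow_pos_of_pos hq0 _
  rcases le_or_gt l₁ (m : ℤ) with hm | hm
  · rw [h m hm, norm_mul, norm_qc hq0, mul_comm]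
    refine mul_le_mul_of_nonneg_right ?_ hp.le
    calc _ ≤ ‖c₁ * c ^ (m : ℤ)‖ + ‖c₂ * c ^ (-(m : ℤ))‖ := norm_add_le _ _
      _ = ‖c₁‖ + ‖c₂‖ := by simp [hc]
      _ ≤ _ := by linarith
  · have h1 := hM' m (by rw [Finset.mem_range]; omega)
    rw [norm_mul, norm_qc hq0, Real.rpow_neg hq0.le, ← div_eq_mul_inv, div_le_iff₀ hp] at h1
    refine h1.trans (mul_le_mul_of_nonneg_right ?_ hp.le)
    linarith [norm_nonneg c₁, norm_nonneg c₂]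

lemma IsAdmissibleFam.exists_norm_le {q : ℝ} {l₁ : ℤ} {a : ℤ → ℕ → ℂ}
    (ha : IsAdmissibleFam q l₁ a) (hq0 : 0 < q) (hq1 : q < 1) (hl₁ : 0 < l₁) :
    ∃ C : ℝ, 0 ≤ C ∧ ∀ (n : ℤ) (m : ℕ),
      ‖a n m‖ ≤ C * q ^ ((max (-n) 0 + max (-(n + m)) 0 : ℤ) : ℝ) := by
  obtain ⟨k₁, k₂, k₃, A, B, h⟩ := ha
  obtain ⟨MA, hMA, hA⟩ := exists_bound_on_finset (Finset.Ioo (-l₁) l₁) A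
  obtain ⟨MB, hMB, hB⟩ := exists_bound_on_finset (Finset.Ioo (-l₁) l₁) B
  obtain ⟨ME, hME, hE⟩ := exists_bound_on_finset
    (Finset.Ioo (-l₁) l₁ ×ˢ Finset.range (2 * l₁).toNat) fun x => a x.1 x.2
  set Q : ℝ := q ^ (-((2 * l₁ : ℤ) : ℝ))
  have hQ : 0 < Q := Real.rpow_pos_of_pos hq0 _
  have hexp : ∀ {M K : ℝ} {e : ℤ}, 0 ≤ M → K ≤ M → e ≤ 2 * l₁ → K ≤ M * Q * q ^ (e : ℝ) := by
    intro M K e hM hK he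
    rw [mul_assoc, ← Real.rpow_add hq0]
    refine hK.trans (le_mul_of_one_le_right hM ?_)
    refine Real.one_le_rpow_of_pos_of_le_one_of_nonpos hq0 hq1.le ?_
    have : (e : ℝ) ≤ ((2 * l₁ : ℤ) : ℝ) := by exact_mod_cast he
    linarith
  have hQ1 : 1 ≤ Q := by
    refine Real.one_le_rpow_of_pos_of_le_one_of_nonpos hq0 hq1.le ?_
    have : (0 : ℝ) ≤ ((2 * l₁ : ℤ) : ℝ) := by exact_mod_cast (by omega)
    linarith
  refine ⟨‖k₁‖ + ‖k₂‖ + ‖k₃‖ + MA * Q + MB * Q + ME * Q, by positivity, fun n m => ?_⟩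
  obtain ⟨h1, h2, h3, h4, h5⟩ := h n m
  have key : ∀ {K : ℝ}, ‖a n m‖ ≤ K * q ^ ((max (-n) 0 + max (-(n + m)) 0 : ℤ) : ℝ) →
      K ≤ ‖k₁‖ + ‖k₂‖ + ‖k₃‖ + MA * Q + MB * Q + ME * Q →
      ‖a n m‖ ≤ (‖k₁‖ + ‖k₂‖ + ‖k₃‖ + MA * Q + MB * Q + ME * Q) *
        q ^ ((max (-n) 0 + max (-(n + m)) 0 : ℤ) : ℝ) := fun h h' =>
    h.trans (mul_le_mul_of_nonneg_right h' (Real.rpow_nonneg hq0.le _))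
  have p1 := norm_nonneg k₁
  have p2 := norm_nonneg k₂
  have p3 := norm_nonneg k₃
  have p4 : 0 ≤ MA * Q := by positivity
  have p5 : 0 ≤ MB * Q := by positivity
  have p6 : 0 ≤ ME * Q := by positivity
  rcases le_or_gt l₁ n with hn | hn
  · refine key (K := ‖k₁‖) ?_ (by linarith)
    rw [h1 hn, show max (-n) 0 + max (-(n + (m : ℤ))) 0 = 0 by omega]
    simp
  rcases lt_or_ge (-l₁) n with hn' | hn'
  · rcases le_or_gt l₁ (n + m) with hp | hp
    · refine key (K := MA * Q) ?_ (by linarith)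
      rw [h2 hn' hn hp]
      exact hexp hMA (hA n (by simp [hn, hn'])) (by omega)
    · refine key (K := ME * Q) (hexp hME (hE (n, m) ?_) (by omega)) (by linarith)
      simp only [Finset.mem_product, Finset.mem_Ioo, Finset.mem_range]
      omega
  rcases le_or_gt l₁ (n + m) with hp | hp
  · refine key (K := ‖k₂‖) ?_ (by linarith)
    rw [h3 hn' hp, show max (-n) 0 + max (-(n + (m : ℤ))) 0 = -n by omega, norm_mul, norm_qc hq0,
      mul_comm]
    simp
  rcases lt_or_ge (-l₁) (n + m) with hp' | hp'
  · refine key (K := MB * Q) ?_ (by linarith)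
    rw [h4 hn' hp' hp, show max (-n) 0 + max (-(n + (m : ℤ))) 0 = -n + max (-(n + (m : ℤ))) 0 by
      omega, norm_mul, norm_qc hq0, Int.cast_add, Real.rpow_add hq0, Int.cast_neg, mul_left_comm]
    refine mul_le_mul_of_nonneg_left ?_ (Real.rpow_nonneg hq0.le _)
    exact hexp hMB (hB _ (by simp [hp, hp'])) (by omega)
  · refine key (K := ‖k₃‖) ?_ (by linarith)
    rw [h5 hp', show max (-n) 0 + max (-(n + (m : ℤ))) 0 = -(2 * n + m) by omega, norm_mul,
      norm_qc hq0, mul_comm]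
    push_cast
    rfl

lemma hasSum_pow_natAbs {x : ℝ} (hx0 : 0 ≤ x) (hx1 : x < 1) :
    HasSum (fun n : ℤ => x ^ n.natAbs) ((1 - x)⁻¹ + (1 - x)⁻¹ * x) := by
  have h := hasSum_geometric_of_lt_one hx0 hx1
  refine HasSum.of_nat_of_neg_add_one (by simpa using h) ?_
  have e : (fun n : ℕ => x ^ (-((n : ℤ) + 1)).natAbs) = fun n : ℕ => x ^ n * x := by
    funext n
    rw [← pow_succ, show (-((n : ℤ) + 1)).natAbs = n + 1 by omega]
  rw [e]
  exact h.mul_right x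

lemma summable_one_add_mul_pow {x : ℝ} (hx0 : 0 ≤ x) (hx1 : x < 1) :
    Summable fun j : ℕ => (1 + (j : ℝ)) * x ^ j := by
  have h1 := summable_pow_mul_geometric_of_norm_lt_one 1
    (show ‖x‖ < 1 by rwa [Real.norm_of_nonneg hx0])
  have h0 := summable_geometric_of_lt_one hx0 hx1
  refine (h0.add h1).congr fun j => ?_
  ring

lemma summable_one_add_natAbs_mul_pow {x : ℝ} (hx0 : 0 ≤ x) (hx1 : x < 1) :
    Summable fun n : ℤ => (1 + (n.natAbs : ℝ)) * x ^ n.natAbs := by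
  have h := summable_one_add_mul_pow hx0 hx1
  exact Summable.of_nat_of_neg (by simpa using h) (by simpa using h)

/-- The product weight `y ^ |n| (1 + |p|) x ^ |p| (1 + j) x ^ j` at `p = n + m`. -/
def weight (y x : ℝ) (p : ℤ × ℕ × ℕ) : ℝ :=
  y ^ p.1.natAbs * (((1 + ((p.1 + p.2.1).natAbs : ℝ)) * x ^ (p.1 + p.2.1).natAbs) *
    ((1 + (p.2.2 : ℝ)) * x ^ p.2.2))

lemma summable_and_tsum_le_of_shear {g h : ℤ → ℝ} {r : ℕ → ℝ} (hg : Summable g)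
    (hh : Summable h) (hr : Summable r) (hg0 : ∀ n, 0 ≤ g n) (hh0 : ∀ n, 0 ≤ h n)
    (hr0 : ∀ j, 0 ≤ r j) :
    (Summable fun p : ℤ × ℕ × ℕ => g p.1 * (h (p.1 + p.2.1) * r p.2.2)) ∧
      ∑' p : ℤ × ℕ × ℕ, g p.1 * (h (p.1 + p.2.1) * r p.2.2) ≤
        (∑' n, g n) * ∑' z : ℤ × ℕ, h z.1 * r z.2 := by
  have hhr : Summable fun z : ℤ × ℕ => h z.1 * r z.2 := hh.mul_of_nonneg hr hh0 hr0
  have hhr0 : ∀ z : ℤ × ℕ, 0 ≤ h z.1 * r z.2 := fun z => mul_nonneg (hh0 _) (hr0 _)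
  have hs : Summable fun z : ℤ × ℤ × ℕ => g z.1 * (h z.2.1 * r z.2.2) :=
    hg.mul_of_nonneg hhr hg0 hhr0
  have hinj : Function.Injective
      (fun p : ℤ × ℕ × ℕ => ((p.1, p.1 + (p.2.1 : ℤ), p.2.2) : ℤ × ℤ × ℕ)) := by
    rintro ⟨n, m, j⟩ ⟨n', m', j'⟩ h
    simp only [Prod.mk.injEq] at h ⊢
    omega
  refine ⟨hs.comp_injective hinj, ?_⟩
  rw [hg.tsum_mul_tsum hhr hs]
  exact tsum_comp_le_tsum_of_inj hs (fun z => mul_nonneg (hg0 _) (hhr0 _)) hinj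

lemma exists_weight_summable {x : ℝ} (hx0 : 0 ≤ x) (hx1 : x < 1) :
    ∃ S : ℝ, 0 ≤ S ∧ ∀ y : ℝ, 0 ≤ y → y < 1 →
      Summable (weight y x) ∧ ∑' p, weight y x p ≤ S * (1 - y)⁻¹ := by
  have hr0 : ∀ j : ℕ, 0 ≤ (1 + (j : ℝ)) * x ^ j := fun j => by positivity
  have hh0 : ∀ n : ℤ, 0 ≤ (1 + (n.natAbs : ℝ)) * x ^ n.natAbs := fun n => by positivity
  have hS : 0 ≤ ∑' z : ℤ × ℕ, ((1 + (z.1.natAbs : ℝ)) * x ^ z.1.natAbs) *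
      ((1 + (z.2 : ℝ)) * x ^ z.2) := tsum_nonneg fun z => mul_nonneg (hh0 _) (hr0 _)
  refine ⟨2 * ∑' z : ℤ × ℕ, ((1 + (z.1.natAbs : ℝ)) * x ^ z.1.natAbs) *
    ((1 + (z.2 : ℝ)) * x ^ z.2), mul_nonneg zero_le_two hS, fun y hy0 hy1 => ?_⟩
  have hg := hasSum_pow_natAbs hy0 hy1
  obtain ⟨hsum, hle⟩ := summable_and_tsum_le_of_shear hg.summable
    (summable_one_add_natAbs_mul_pow hx0 hx1) (summable_one_add_mul_pow hx0 hx1)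
    (fun n => pow_nonneg hy0 _) hh0 hr0
  refine ⟨hsum, hle.trans ?_⟩
  rw [hg.tsum_eq]
  have h1 : 0 < (1 - y)⁻¹ := inv_pos.2 (by linarith)
  have h2 : (1 - y)⁻¹ + (1 - y)⁻¹ * y ≤ 2 * (1 - y)⁻¹ := by nlinarith
  refine (mul_le_mul_of_nonneg_right h2 hS).trans_eq ?_
  ring

/-- component of claim (3) with `l ≥ max(l₁, n+m+1)`,
written `l = max l₁ (n+m+1) + j`. -/
theorem stmt11 (q : ℝ) (hq0 : 0 < q) (hq1 : q < 1) (c α : ℂ)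
    (hc : ‖c‖ = 1) (hα : ‖α‖ = 1) (l₁ : ℤ) (hl₁ : 0 < l₁)
    (d : ℕ → ℂ) (hd : IsAdmissibleSeq q c l₁ d)
    (a : ℤ → ℕ → ℂ) (ha : IsAdmissibleFam q l₁ a)
    (T : ℝ → ℤ × ℕ × ℕ → ℂ)
    (hT : ∀ (s : ℝ) (n : ℤ) (m j : ℕ),
      T s (n, m, j) = c ^ (2 * n + (m : ℤ)) * qc q ((n : ℝ) - (m : ℝ) / 2) * d m * a n m *
        (c⁻¹ * α⁻¹) ^ (max l₁ (n + (m : ℤ) + 1) + (j : ℤ)) *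
        qc q ((((max l₁ (n + (m : ℤ) + 1) : ℤ) : ℝ) + (j : ℝ)) / 2) *
        (qc q (s * (2 * (((max l₁ (n + (m : ℤ) + 1) : ℤ) : ℝ) + (j : ℝ)) -
            2 * (n : ℝ) - (m : ℝ))) -
         qc q (s * (((|n + (m : ℤ)| : ℤ) : ℝ) + ((|n| : ℤ) : ℝ))))) :
    (∀ s : ℝ, 0 < s → Summable fun p : ℤ × ℕ × ℕ => ‖T s p‖) ∧
    Tendsto (fun s : ℝ => (s : ℂ) * ∑' p : ℤ × ℕ × ℕ, T s p)
      (𝓝[>] (0 : ℝ)) (𝓝 0) := by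
  obtain ⟨D, hD, hd'⟩ := hd.exists_norm_le hq0 hc
  obtain ⟨C, hC, ha'⟩ := ha.exists_norm_le hq0 hq1 hl₁
  set L : ℝ := -Real.log q
  have hL : 0 < L := neg_pos.2 (Real.log_neg hq0 hq1)
  set x : ℝ := q ^ (1 / 2 : ℝ)
  have hx0 : 0 ≤ x := Real.rpow_nonneg hq0.le _
  have hx1 : x < 1 := Real.rpow_lt_one hq0.le hq1 (by norm_num)
  obtain ⟨S, hS, hW⟩ := exists_weight_summable hx0 hx1
  set M : ℝ := 2 * l₁ + 6
  have hM : 0 ≤ M := by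
    have : (0 : ℝ) < l₁ := by exact_mod_cast hl₁
    positivity
  have bound : ∀ s t : ℝ, 0 < s → t ≤ s → t ≤ 1 → ∀ p,
      ‖T s p‖ ≤ D * C * L * M * s * weight (q ^ t) x p := by
    rintro s t hs hts ht1 ⟨n, m, j⟩
    set l : ℤ := max l₁ (n + (m : ℤ) + 1) + j with hl
    have hlr : ((max l₁ (n + (m : ℤ) + 1) : ℤ) : ℝ) + (j : ℝ) = (l : ℝ) := by
      rw [hl]; push_cast; rfl
    have hbr : ‖qc q (s * (2 * (l : ℝ) - 2 * (n : ℝ) - (m : ℝ))) -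
        qc q (s * (((|n + (m : ℤ)| : ℤ) : ℝ) + ((|n| : ℤ) : ℝ)))‖ ≤
        q ^ (s * ((max (-n) 0 : ℤ) : ℝ)) *
          (s * L * (M * ((1 + ((n + m).natAbs : ℝ)) * (1 + (j : ℝ))))) := by
      have e1 : (2 * (l : ℝ) - 2 * (n : ℝ) - (m : ℝ)) = ((2 * l - 2 * n - m : ℤ) : ℝ) := by
        push_cast; ring
      have e2 : (((|n + (m : ℤ)| : ℤ) : ℝ) + ((|n| : ℤ) : ℝ)) =
          ((|n + (m : ℤ)| + |n| : ℤ) : ℝ) := by push_cast; ring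
      rw [e1, e2, qc, qc, ← Complex.ofReal_sub, Complex.norm_real, Real.norm_eq_abs]
      have i1 : max (-n) 0 ≤ 2 * l - 2 * n - m := by omega
      have i2 : max (-n) 0 ≤ |n + (m : ℤ)| + |n| := by
        rcases abs_cases n with h | h <;> rcases abs_cases (n + (m : ℤ)) with h' | h' <;> omega
      refine (abs_rpow_sub_rpow_le hq0 hq1 hs (Int.cast_le.2 i1) (Int.cast_le.2 i2)).trans ?_
      refine mul_le_mul_of_nonneg_left ?_ (Real.rpow_nonneg hq0.le _)
      refine mul_le_mul_of_nonneg_left ?_ (mul_nonneg hs.le hL.le)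
      have i3 : |2 * l - 2 * n - m - (|n + (m : ℤ)| + |n|)| ≤
          2 * l₁ + 2 + 2 * j + 6 * ((n + m).natAbs : ℤ) := by
        rcases abs_cases n with h | h <;> rcases abs_cases (n + (m : ℤ)) with h' | h' <;>
          rw [abs_le] <;> omega
      have i4 : |((2 * l - 2 * n - m : ℤ) : ℝ) - ((|n + (m : ℤ)| + |n| : ℤ) : ℝ)| ≤
          2 * l₁ + 2 + 2 * j + 6 * ((n + m).natAbs : ℝ) := by
        have := (Int.cast_le (R := ℝ)).2 i3
        rw [Int.cast_abs, Int.cast_sub] at this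
        refine this.trans_eq ?_
        simp
      refine i4.trans ?_
      have hl₁' : (0 : ℝ) < l₁ := by exact_mod_cast hl₁
      have hj : (0 : ℝ) ≤ j := j.cast_nonneg
      have hP : (0 : ℝ) ≤ ((n + m).natAbs : ℝ) := Nat.cast_nonneg _
      have := mul_nonneg hP hj
      have := mul_nonneg hl₁'.le hj
      have := mul_nonneg hl₁'.le hP
      have := mul_nonneg hl₁'.le (mul_nonneg hP hj)
      simp only [M]
      linarith
    have hexp : q ^ ((n : ℝ) - (m : ℝ) / 2) * q ^ ((m : ℝ) / 2) *
        q ^ ((max (-n) 0 + max (-(n + m)) 0 : ℤ) : ℝ) * q ^ ((l : ℝ) / 2) *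
        q ^ (s * ((max (-n) 0 : ℤ) : ℝ)) ≤
        (q ^ t) ^ n.natAbs * x ^ (n + m).natAbs * x ^ j := by
      simp only [x, ← Real.rpow_natCast, ← Real.rpow_mul hq0.le, ← Real.rpow_add hq0]
      refine Real.rpow_le_rpow_of_exponent_ge hq0 hq1.le ?_
      have k1 : ((n + m).natAbs : ℤ) + j ≤ 2 * max (-(n + m)) 0 + l := by omega
      have k1' : ((n + m).natAbs : ℝ) + j ≤ 2 * ((max (-(n + m)) 0 : ℤ) : ℝ) + l := by
        have := (Int.cast_le (R := ℝ)).2 k1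
        simpa only [Int.cast_add, Int.cast_mul, Int.cast_natCast, Int.cast_ofNat] using this
      have k2 : t * (n.natAbs : ℝ) ≤
          n + ((max (-n) 0 : ℤ) : ℝ) + s * ((max (-n) 0 : ℤ) : ℝ) := by
        rcases le_total 0 n with h | h
        · have e : ((n.natAbs : ℤ) : ℝ) = n := by rw [Int.natAbs_of_nonneg h]
          have hn : (0 : ℝ) ≤ n := by exact_mod_cast h
          rw [Int.cast_natCast] at e
          rw [max_eq_right (by omega), e, Int.cast_zero]
          nlinarith
        · have e : ((n.natAbs : ℤ) : ℝ) = -n := by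
            rw [Int.ofNat_natAbs_of_nonpos h, Int.cast_neg]
          have hn : (n : ℝ) ≤ 0 := by exact_mod_cast h
          rw [Int.cast_natCast] at e
          rw [max_eq_left (by omega), e, Int.cast_neg]
          nlinarith
      rw [Int.cast_add]
      linarith
    have hnorm : ‖T s (n, m, j)‖ = q ^ ((n : ℝ) - (m : ℝ) / 2) * ‖d m‖ * ‖a n m‖ *
        q ^ ((l : ℝ) / 2) * ‖qc q (s * (2 * (l : ℝ) - 2 * (n : ℝ) - (m : ℝ))) -
        qc q (s * (((|n + (m : ℤ)| : ℤ) : ℝ) + ((|n| : ℤ) : ℝ)))‖ := by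
      rw [hT, hlr]
      simp only [norm_mul, norm_zpow, norm_inv, hc, hα, norm_qc hq0, one_zpow, inv_one, mul_one,
        one_mul]
    have hpos : ∀ u : ℝ, 0 ≤ q ^ u := fun u => Real.rpow_nonneg hq0.le u
    rw [hnorm]
    calc _ ≤ q ^ ((n : ℝ) - (m : ℝ) / 2) * (D * q ^ ((m : ℝ) / 2)) *
          (C * q ^ ((max (-n) 0 + max (-(n + m)) 0 : ℤ) : ℝ)) * q ^ ((l : ℝ) / 2) *
          (q ^ (s * ((max (-n) 0 : ℤ) : ℝ)) *
          (s * L * (M * ((1 + ((n + m).natAbs : ℝ)) * (1 + (j : ℝ)))))) := by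
          have := hd' m
          have := ha' n m
          have := hpos
          gcongr
      _ = D * C * L * M * s * ((1 + ((n + m).natAbs : ℝ)) * (1 + (j : ℝ))) *
          (q ^ ((n : ℝ) - (m : ℝ) / 2) * q ^ ((m : ℝ) / 2) *
          q ^ ((max (-n) 0 + max (-(n + m)) 0 : ℤ) : ℝ) * q ^ ((l : ℝ) / 2) *
          q ^ (s * ((max (-n) 0 : ℤ) : ℝ))) := by ring
      _ ≤ D * C * L * M * s * ((1 + ((n + m).natAbs : ℝ)) * (1 + (j : ℝ))) *
          ((q ^ t) ^ n.natAbs * x ^ (n + m).natAbs * x ^ j) :=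
          mul_le_mul_of_nonneg_left hexp (by positivity)
      _ = _ := by rw [weight]; ring
  have hsum : ∀ s : ℝ, 0 < s → Summable fun p : ℤ × ℕ × ℕ => ‖T s p‖ := fun s hs =>
    Summable.of_nonneg_of_le (fun _ => norm_nonneg _)
      (bound s (min s 1) hs (min_le_left _ _) (min_le_right _ _))
      ((hW _ (Real.rpow_nonneg hq0.le _)
        (Real.rpow_lt_one hq0.le hq1 (lt_min hs one_pos))).1.mul_left _)
  refine ⟨hsum, ?_⟩
  have hlim : Tendsto (fun s : ℝ => D * C * L * M * S * (1 - q)⁻¹ * s) (𝓝[>] (0 : ℝ)) (𝓝 0) := by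
    have h : Tendsto (fun s : ℝ => D * C * L * M * S * (1 - q)⁻¹ * s) (𝓝 0)
        (𝓝 (D * C * L * M * S * (1 - q)⁻¹ * 0)) := tendsto_id.const_mul _
    rw [mul_zero] at h
    exact h.mono_left nhdsWithin_le_nhds
  refine squeeze_zero_norm' ?_ hlim
  filter_upwards [Ioc_mem_nhdsGT (zero_lt_one' ℝ)] with s hs
  obtain ⟨hs0, hs1⟩ := hs
  obtain ⟨hws, hwle⟩ := hW (q ^ s) (Real.rpow_nonneg hq0.le _) (Real.rpow_lt_one hq0.le hq1 hs0)
  have hq' : 0 < 1 - q := by linarith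
  have hber : s * (1 - q) ≤ 1 - q ^ s := by
    have := rpow_one_add_le_one_add_mul_self (s := q - 1) (by linarith) hs0.le hs1
    rw [add_sub_cancel] at this
    linarith
  have hinv : (1 - q ^ s)⁻¹ ≤ (s * (1 - q))⁻¹ := inv_anti₀ (by positivity) hber
  rw [norm_mul, Complex.norm_real, Real.norm_of_nonneg hs0.le]
  calc s * ‖∑' p, T s p‖ ≤ s * ∑' p, ‖T s p‖ :=
        mul_le_mul_of_nonneg_left (norm_tsum_le_tsum_norm (hsum s hs0)) hs0.le
    _ ≤ s * ∑' p, D * C * L * M * s * weight (q ^ s) x p :=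
        mul_le_mul_of_nonneg_left
          ((hsum s hs0).tsum_le_tsum (bound s s hs0 le_rfl hs1) (hws.mul_left _)) hs0.le
    _ = s * (D * C * L * M * s * ∑' p, weight (q ^ s) x p) := by rw [tsum_mul_left]
    _ ≤ s * (D * C * L * M * s * (S * (s * (1 - q))⁻¹)) := by
        have := hwle.trans (mul_le_mul_of_nonneg_left hinv hS)
        gcongr
    _ = _ := by field_simp
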